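/- arXiv:1608.06182 — 6 statements merged into one kernel-verified Lean document; each statement's English description precedes it below -/
import Mathlib

section
/- Let H be a complex Hilbert space and let L₀, L₁ : H → H be continuous linear maps that are self-adjoint and nonnegative, i.e. ⟨u, L₀ u⟩ ≥ 0 and ⟨u, L₁ u⟩ ≥ 0 (as real numbers) for all u ∈ H. If λ ∈ ℂ and u ∈ H with u ≠ 0 satisfy L₀ u + λ • (L₁ u) + λ² • u = 0, then Re λ ≤ 0. -/
open scoped InnerProductSpace

/-- A root of a real quadratic with nonnegative lower coefficients and positive leading
coefficient lies in the closed left half-plane. -/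
theorem re_nonpos_of_nonneg_quadratic {a b c : ℝ} (ha : 0 ≤ a) (hb : 0 ≤ b) (hc : 0 < c) {z : ℂ}
    (h : (a : ℂ) + z * b + z ^ 2 * c = 0) : z.re ≤ 0 := by
  by_contra! hz
  have hre := congrArg Complex.re h
  have him := congrArg Complex.im h
  simp [pow_two] at hre him
  have hpos : 0 < b + 2 * z.re * c := by positivity
  have hprod : z.im * (b + 2 * z.re * c) = 0 := by linarith
  have hy : z.im = 0 := (mul_eq_zero.mp hprod).resolve_right hpos.ne'
  rw [hy] at hre
  have : 0 < a + z.re * b + z.re * z.re * c := by positivity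
  linarith

/-- The quadratic form of a self-adjoint operator is real. -/
theorem IsSelfAdjoint.ofReal_re_inner_apply_self
    {H : Type*} [NormedAddCommGroup H] [InnerProductSpace ℂ H] [CompleteSpace H]
    {A : H →L[ℂ] H} (hA : IsSelfAdjoint A) (u : H) :
    ((⟪u, A u⟫_ℂ).re : ℂ) = ⟪u, A u⟫_ℂ := by
  rw [← Complex.conj_eq_iff_re, inner_conj_symm]
  exact hA.isSymmetric u u

/-- If `L₀`, `L₁` are self-adjoint nonnegative continuous linear operators on a complex
Hilbert space and `L₀u + λL₁u + λ²u = 0` with `u ≠ 0`, then `Re λ ≤ 0`. -/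
theorem pencil_nonneg_damping_re_nonpos
    {H : Type*} [NormedAddCommGroup H] [InnerProductSpace ℂ H] [CompleteSpace H]
    (L₀ L₁ : H →L[ℂ] H)
    (hL₀sa : IsSelfAdjoint L₀) (hL₁sa : IsSelfAdjoint L₁)
    (hL₀ : ∀ u : H, 0 ≤ (⟪u, L₀ u⟫_ℂ).re) (hL₁ : ∀ u : H, 0 ≤ (⟪u, L₁ u⟫_ℂ).re)
    (lam : ℂ) (u : H) (hu : u ≠ 0)
    (heq : L₀ u + lam • (L₁ u) + lam ^ 2 • u = 0) :
    lam.re ≤ 0 := by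
  have hc : 0 < ‖u‖ ^ 2 := by positivity
  refine re_nonpos_of_nonneg_quadratic (hL₀ u) (hL₁ u) hc ?_
  rw [hL₀sa.ofReal_re_inner_apply_self, hL₁sa.ofReal_re_inner_apply_self]
  have h := congrArg (fun v => ⟪u, v⟫_ℂ) heq
  simpa [inner_add_right, inner_smul_right, inner_self_eq_norm_sq_to_K] using h
end

section
/- Let P be a real polynomial that is monic of even degree k ≥ 2, and let λ ∈ ℂ. If v : ℝ → ℂ is differentiable, satisfies v′(x) = (λ − P(x))·v(x) for all x ∈ ℝ, and v is bounded on ℝ, then v is identically zero. -/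
open Filter Topology in
/-- A polynomial of positive even degree with positive leading coefficient tends to `∞` at `-∞`. -/
theorem Polynomial.tendsto_atBot_atTop_of_even_natDegree {P : Polynomial ℝ}
    (heven : Even P.natDegree) (hpos : 0 < P.natDegree) (hlead : 0 < P.leadingCoeff) :
    Tendsto (fun x => P.eval x) atBot atTop := by
  refine (Polynomial.isEquivalent_atBot_lead P).symm.tendsto_atTop ?_
  refine Tendsto.const_mul_atTop hlead ?_
  simpa only [Function.comp_def, heven.pow_abs] using
    (tendsto_pow_atTop hpos.ne').comp (tendsto_abs_atBot_atTop (G := ℝ))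

/-- A solution of `v' = a v` with `a` continuous that vanishes at one point vanishes everywhere. -/
theorem eq_zero_of_hasDerivAt_mul_of_eq_zero {a v : ℝ → ℂ} (ha : Continuous a)
    (hv : ∀ x, HasDerivAt v (a x * v x) x) {b : ℝ} (hb : v b = 0) (x : ℝ) : v x = 0 := by
  set A : ℝ → ℂ := fun x => ∫ t in b..x, a t
  have hA (x : ℝ) : HasDerivAt A (a x) x := ha.integral_hasStrictDerivAt b x |>.hasDerivAt
  have hw (x : ℝ) : HasDerivAt (fun x => v x * Complex.exp (-A x)) 0 x := by
    refine ((hv x).mul (hA x).neg.cexp).congr_deriv ?_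
    simp only [Pi.neg_apply]
    ring
  have hconst := is_const_of_deriv_eq_zero (fun x => (hw x).differentiableAt)
    (fun x => (hw x).deriv) x b
  simpa [hb] using hconst

open Filter Topology in
/-- A bounded solution of `v' = a v` vanishes on any left half-line on which `Re a ≤ -1`. -/
theorem eq_zero_of_hasDerivAt_mul_of_re_le {a v : ℝ → ℂ}
    (hv : ∀ x, HasDerivAt v (a x * v x) x) {M : ℝ} (hM : ∀ x, ‖v x‖ ≤ M)
    {b : ℝ} (ha : ∀ x ≤ b, (a x).re ≤ -1) : v b = 0 := by
  set f : ℝ → ℝ := fun x => Real.exp (2 * x) * ‖v x‖ ^ 2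
  have hf (x : ℝ) : HasDerivAt f (2 * Real.exp (2 * x) * ((1 + (a x).re) * ‖v x‖ ^ 2)) x := by
    refine (((hasDerivAt_id x).const_mul 2).exp.mul (hv x).norm_sq).congr_deriv ?_
    simp only [Complex.inner, Complex.sq_norm, Complex.normSq_apply, Complex.mul_re,
      Complex.mul_im, Complex.conj_re, Complex.conj_im, id]
    ring
  have hanti : AntitoneOn f (Set.Iic b) := by
    refine antitoneOn_of_deriv_nonpos (convex_Iic b)
      (fun x _ => (hf x).continuousAt.continuousWithinAt)
      (fun x _ => (hf x).differentiableAt.differentiableWithinAt) fun x hx => ?_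
    rw [(hf x).deriv]
    have hx' := ha x (interior_subset (s := Set.Iic b) hx)
    exact mul_nonpos_of_nonneg_of_nonpos (by positivity)
      (mul_nonpos_of_nonpos_of_nonneg (by linarith) (by positivity))
  have hlim : Tendsto (fun x : ℝ => Real.exp (2 * x) * M ^ 2) atBot (𝓝 0) := by
    simpa using (Real.tendsto_exp_atBot.comp
      (tendsto_id.const_mul_atBot (two_pos : (0 : ℝ) < 2))).mul_const (M ^ 2)
  have hle : f b ≤ 0 := by
    refine ge_of_tendsto hlim ?_
    filter_upwards [eventually_le_atBot b] with y hy
    refine (hanti hy (Set.mem_Iic.2 le_rfl) hy).trans ?_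
    have := hM y
    simp only [f]
    gcongr
  have hsq : ‖v b‖ ^ 2 ≤ 0 := nonpos_of_mul_nonpos_right hle (Real.exp_pos _)
  simpa using le_antisymm hsq (by positivity)

/-- If `P` is a monic real polynomial of even degree `k ≥ 2` and `v : ℝ → ℂ` is a bounded
solution of `v′(x) = (λ − P(x))v(x)`, then `v ≡ 0`. -/
theorem bounded_solution_first_order_eq_zero
    (P : Polynomial ℝ) (k : ℕ) (hk : 2 ≤ k) (hkeven : Even k)
    (hdeg : P.natDegree = k) (hmonic : P.Monic) (lam : ℂ) (v : ℝ → ℂ)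
    (hv : ∀ x : ℝ, HasDerivAt v ((lam - ((P.eval x : ℝ) : ℂ)) * v x) x)
    (hbd : ∃ M : ℝ, ∀ x : ℝ, ‖v x‖ ≤ M) :
    ∀ x : ℝ, v x = 0 := by
  obtain ⟨M, hM⟩ := hbd
  have hP := Polynomial.tendsto_atBot_atTop_of_even_natDegree (P := P) (hdeg ▸ hkeven)
    (by omega) (by simp [hmonic.leadingCoeff])
  obtain ⟨b, hb⟩ := Filter.eventually_atBot.1 (hP.eventually_ge_atTop (lam.re + 1))
  have hvb : v b = 0 := by
    refine eq_zero_of_hasDerivAt_mul_of_re_le hv hM fun x hx => ?_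
    have := hb x hx
    simp only [Complex.sub_re, Complex.ofReal_re]
    linarith
  exact eq_zero_of_hasDerivAt_mul_of_eq_zero (by fun_prop) hv hvb
end

section
/- Let P be a real polynomial that is monic of even degree k ≥ 2, and let P′ denote its derivative. For every λ ∈ ℂ, the only function u in the Schwartz space 𝒮(ℝ, ℂ) satisfying −u″(x) + (P(x) − λ)²·u(x) + P′(x)·u(x) = 0 for all x ∈ ℝ is u ≡ 0. In other words, the operator pencil L_P^#(λ) = −d²/dx² + (P − λ)² + P′ has empty spectrum: Sp[L_P^#] = ∅. -/
open Polynomial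
open Filter Topology

/-- A decaying solution of `w' = f w` vanishes when `Re f ≥ 0` near `+∞`. -/
theorem eq_zero_of_hasDerivAt_mul_of_tendsto_zero {f w : ℝ → ℂ} (hf : Continuous f)
    (hw : ∀ x, HasDerivAt w (f x * w x) x) (hre : ∀ᶠ x in atTop, 0 ≤ (f x).re)
    (hlim : Tendsto w atTop (𝓝 0)) (x : ℝ) : w x = 0 := by
  obtain ⟨M, hM⟩ := eventually_atTop.1 hre
  have hnorm : ∀ x, HasDerivAt (fun y => ‖w y‖ ^ 2) (2 * ((f x).re * ‖w x‖ ^ 2)) x := by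
    intro x
    convert (hw x).norm_sq using 2
    rw [Complex.inner, ← Complex.normSq_eq_norm_sq, Complex.normSq_apply]
    simp only [Complex.mul_re, Complex.mul_im, Complex.conj_re, Complex.conj_im]
    ring
  have hmono : MonotoneOn (fun y => ‖w y‖ ^ 2) (Set.Ici M) := by
    refine monotoneOn_of_deriv_nonneg (convex_Ici M)
      (fun y _ => (hnorm y).continuousAt.continuousWithinAt)
      (fun y _ => (hnorm y).differentiableAt.differentiableWithinAt) fun y hy => ?_
    rw [(hnorm y).deriv]
    have := hM y (interior_subset hy)
    positivity
  have hM0 : w M = 0 := by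
    have hle : ‖w M‖ ^ 2 ≤ 0 := by
      refine ge_of_tendsto (x := atTop) (f := fun y => ‖w y‖ ^ 2)
        (by simpa using hlim.norm.pow 2) ?_
      filter_upwards [eventually_ge_atTop M] with y hy
      exact hmono Set.self_mem_Ici hy hy
    simpa using hle.antisymm (by positivity)
  have hF : ∀ y, HasDerivAt (fun t => ∫ s in M..t, f s) (f y) y := fun y =>
    (hf.integral_hasStrictDerivAt M y).hasDerivAt
  have hg : ∀ y, HasDerivAt (fun t => w t * Complex.exp (-∫ s in M..t, f s)) 0 y := by
    intro y
    refine ((hw y).mul (hF y).neg.cexp).congr_deriv ?_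
    simp only [Pi.neg_apply]
    ring
  have hconst := is_const_of_deriv_eq_zero (fun y => (hg y).differentiableAt)
    (fun y => (hg y).deriv) x M
  simpa [hM0, Complex.exp_ne_zero] using hconst

theorem Polynomial.hasTemperateGrowth_ofReal_eval (P : ℝ[X]) :
    Function.HasTemperateGrowth (fun x : ℝ => ((P.eval x : ℝ) : ℂ)) := by
  refine Function.HasTemperateGrowth.comp Function.Complex.hasTemperateGrowth_ofReal (f := fun x => P.eval x) ?_
  simp only [Polynomial.eval_eq_sum_range]
  exact .sum fun i _ => (Function.HasTemperateGrowth.const (P.coeff i)).mul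
    (Function.HasTemperateGrowth.id'.pow i)

theorem Polynomial.Monic.tendsto_eval_neg_atTop {P : ℝ[X]} (hP : P.Monic) (hpos : 0 < P.natDegree)
    (heven : Even P.natDegree) : Tendsto (fun x => P.eval (-x)) atTop atTop := by
  have h := (P.comp (-X)).tendsto_atTop_of_leadingCoeff_nonneg
    (natDegree_pos_iff_degree_pos.1 (by simpa [natDegree_comp] using hpos))
    (by rw [leadingCoeff_comp (by simp)]; simp [hP.leadingCoeff, heven.neg_one_pow])
  simpa using h

/-- For `P` a monic real polynomial of even degree `k ≥ 2`, the pencil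
`L_P^#(λ) = −d²/dx² + (P − λ)² + P′` has no nonzero Schwartz eigenfunction for any `λ`:
its spectrum is empty. -/
theorem pencil_sharp_empty_spectrum
    (P : Polynomial ℝ) (k : ℕ) (hk : 2 ≤ k) (hkeven : Even k)
    (hdeg : P.natDegree = k) (hmonic : P.Monic) (lam : ℂ)
    (u : SchwartzMap ℝ ℂ)
    (heq : ∀ x : ℝ, -(deriv (deriv (u : ℝ → ℂ)) x)
      + (((P.eval x : ℝ) : ℂ) - lam) ^ 2 * u x
      + ((P.derivative.eval x : ℝ) : ℂ) * u x = 0) :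
    u = 0 := by
  have hpos : 0 < P.natDegree := by omega
  have htop : Tendsto (fun x => P.eval x) atTop atTop :=
    P.tendsto_atTop_of_leadingCoeff_nonneg (natDegree_pos_iff_degree_pos.1 hpos)
      (by simp [hmonic.leadingCoeff])
  have hbot := hmonic.tendsto_eval_neg_atTop hpos (hdeg ▸ hkeven)
  have hgrowth : Function.HasTemperateGrowth (fun x : ℝ => ((P.eval x : ℝ) : ℂ) - lam) :=
    P.hasTemperateGrowth_ofReal_eval.sub (.const lam)
  have hcont : Continuous fun x : ℝ => ((P.eval x : ℝ) : ℂ) - lam := by fun_prop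
  let w : SchwartzMap ℝ ℂ :=
    SchwartzMap.smulLeftCLM ℂ (fun x : ℝ => ((P.eval x : ℝ) : ℂ) - lam) u
      - SchwartzMap.derivCLM ℂ ℂ u
  have hw : ∀ x, w x = (((P.eval x : ℝ) : ℂ) - lam) * u x - deriv u x := by
    intro x
    simp [w, SchwartzMap.smulLeftCLM_apply_apply hgrowth]
  have hu2 : ∀ x, HasDerivAt (deriv u) (deriv (deriv u) x) x := by
    have hcoe : deriv u = SchwartzMap.derivCLM ℂ ℂ u := by ext x; simp
    intro x
    rw [hcoe]
    exact SchwartzMap.hasDerivAt _ x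
  have hwderiv : ∀ x, HasDerivAt w (-(((P.eval x : ℝ) : ℂ) - lam) * w x) x := by
    intro x
    rw [funext hw]
    refine (((((P.hasDerivAt x).ofReal_comp).sub_const lam).mul (u.hasDerivAt x)).sub
      (hu2 x)).congr_deriv ?_
    linear_combination heq x
  have hw0 : ∀ x, w x = 0 := by
    intro x
    have hrefl : ∀ y, HasDerivAt (fun t => w (-t))
        ((((P.eval (-y) : ℝ) : ℂ) - lam) * w (-y)) y := by
      intro y
      refine ((hwderiv (-y)).scomp y (hasDerivAt_neg y)).congr_deriv ?_
      simp only [neg_smul, one_smul]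
      ring
    have := eq_zero_of_hasDerivAt_mul_of_tendsto_zero (hcont.comp continuous_neg) hrefl
      (by filter_upwards [hbot.eventually_ge_atTop lam.re] with y hy; simpa using hy)
      (w.tendsto_cocompact.comp (tendsto_neg_atTop_atBot.mono_right atBot_le_cocompact)) (-x)
    simpa using this
  have hu : ∀ x, HasDerivAt u ((((P.eval x : ℝ) : ℂ) - lam) * u x) x := by
    intro x
    refine (u.hasDerivAt x).congr_deriv ?_
    linear_combination hw x - hw0 x
  ext x
  exact eq_zero_of_hasDerivAt_mul_of_tendsto_zero hcont hu
    (by filter_upwards [htop.eventually_ge_atTop lam.re] with y hy; simpa using hy)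
    (u.tendsto_cocompact.mono_left atTop_le_cocompact) x
end

section
/- For every λ ∈ ℂ, the only function u in the Schwartz space 𝒮(ℝ, ℂ) satisfying −u″(x) + (x − λ)²·u(x) = 0 for all x ∈ ℝ is u ≡ 0. That is, the equation (−d²/dx² + (x − λ)²)u = 0 has only the trivial solution for every complex λ. -/
open Complex in
/-- A solution of `2ξG' = -(1 + 4π²ξ² + 4πicξ)G` that is regular at the singular point `ξ = 0`
vanishes identically. -/
lemma eq_zero_of_singular_first_order_ode {G G' : ℝ → ℂ} (c : ℂ)
    (hG : ∀ x, HasDerivAt G (G' x) x)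
    (hode : ∀ x : ℝ,
      2 * x * G' x = -(1 + 4 * Real.pi ^ 2 * x ^ 2 + 4 * Real.pi * I * c * x) * G x) :
    G = 0 := by
  let E : ℝ → ℂ := fun x ↦ cexp (2 * Real.pi ^ 2 * x ^ 2 + 4 * Real.pi * I * c * x)
  have hid (x : ℝ) : HasDerivAt (fun y : ℝ ↦ (y : ℂ)) 1 x := ofRealCLM.hasDerivAt
  have hE (x : ℝ) : HasDerivAt E (E x * (4 * Real.pi ^ 2 * x + 4 * Real.pi * I * c)) x := by
    have h := (((hid x).fun_pow 2).const_mul (2 * (Real.pi : ℂ) ^ 2)).fun_add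
      ((hid x).const_mul (4 * Real.pi * I * c))
    convert h.cexp using 1
    simp only [E]
    push_cast
    ring
  have hK (x : ℝ) : HasDerivAt (fun y : ℝ ↦ (y : ℂ) * G y ^ 2 * E y) 0 x := by
    refine (((hid x).fun_mul ((hG x).fun_pow 2)).fun_mul (hE x)).congr_deriv ?_
    push_cast
    linear_combination (E x * G x) * hode x
  have hne (x : ℝ) (hx : x ≠ 0) : G x = 0 := by
    have h := is_const_of_deriv_eq_zero (fun y ↦ (hK y).differentiableAt)
      (fun y ↦ (hK y).deriv) x 0
    simpa [E, hx, exp_ne_zero] using h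
  have hcont : Continuous G := continuous_iff_continuousAt.2 fun x ↦ (hG x).continuousAt
  exact hcont.ext_on (dense_compl_singleton 0) continuous_const hne

open MeasureTheory Complex FourierTransform in
/-- The Fourier transform reduces the equation `(w' + 2(x - c)w)' = w` to a first order equation
that is singular at the origin, so it has no nonzero solution in a weighted `L¹` space. -/
lemma eq_zero_of_hasDerivAt_deriv_add_mul {w w' : ℝ → ℂ} (c : ℂ)
    (hw : ∀ x, HasDerivAt w (w' x) x)
    (hf : ∀ x, HasDerivAt (fun y : ℝ ↦ w' y + 2 * (y - c) * w y) (w x) x)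
    (hint : Integrable w) (hxint : Integrable fun x : ℝ ↦ x • w x) (hint' : Integrable w') :
    w = 0 := by
  have hxint' : Integrable fun x : ℝ ↦ (-2 * Real.pi * I * x) • w x := by
    convert hxint.const_mul (-2 * Real.pi * I) using 2
    simp only [smul_eq_mul, real_smul]
    ring
  have hfeq : (fun y : ℝ ↦ w' y + 2 * (y - c) * w y) =
      w' + (I / Real.pi) • (fun x : ℝ ↦ (-2 * Real.pi * I * x) • w x) + (-2 * c) • w := by
    ext x
    have hpi : (Real.pi : ℂ) ≠ 0 := ofReal_ne_zero.2 Real.pi_ne_zero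
    simp only [Pi.add_apply, Pi.smul_apply, smul_eq_mul]
    field_simp
    linear_combination (2 * x * w x) * I_sq
  have hadd {f g : ℝ → ℂ} (hf : Integrable f) (hg : Integrable g) : 𝓕 (f + g) = 𝓕 f + 𝓕 g :=
    VectorFourier.fourierIntegral_add Real.continuous_fourierChar (innerSL ℝ).continuous₂ hf hg
  have hsmul (r : ℂ) (f : ℝ → ℂ) : 𝓕 (r • f) = r • 𝓕 f :=
    VectorFourier.fourierIntegral_const_smul _ _ _ _ _
  have hw'eq : deriv w = w' := funext fun x ↦ (hw x).deriv
  have hF' : 𝓕 w' = fun x : ℝ ↦ (2 * Real.pi * I * x) • 𝓕 w x := by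
    rw [← hw'eq]
    exact Real.fourier_deriv hint (fun x ↦ (hw x).differentiableAt) (hw'eq ▸ hint')
  have hsum := (hint'.add (hxint'.smul (I / (Real.pi : ℂ)))).add (hint.smul (-2 * c))
  have hF := Real.fourier_deriv (hfeq ▸ hsum) (fun x ↦ (hf x).differentiableAt)
    (by rwa [funext fun x ↦ (hf x).deriv])
  rw [funext fun x ↦ (hf x).deriv, hfeq,
    hadd (hint'.add (hxint'.smul _)) (hint.smul _), hadd hint' (hxint'.smul _), hsmul, hsmul,
    hF'] at hF
  have hzero : 𝓕 w = 0 := by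
    refine eq_zero_of_singular_first_order_ode c
      (fun x ↦ Real.hasDerivAt_fourier hint hxint x) fun x ↦ ?_
    have h := congrFun hF x
    have hpi : (Real.pi : ℂ) ≠ 0 := ofReal_ne_zero.2 Real.pi_ne_zero
    simp only [Pi.add_apply, Pi.smul_apply, smul_eq_mul] at h ⊢
    generalize 𝓕 (fun y : ℝ ↦ -2 * Real.pi * I * y * w y) x = D at h ⊢
    field_simp at h
    linear_combination h + (4 * Real.pi ^ 2 * x ^ 2 * 𝓕 w x + 2 * x * D) * I_sq
  have hcont : Continuous w := continuous_iff_continuousAt.2 fun x ↦ (hw x).continuousAt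
  have hinv := hcont.fourierInv_fourier_eq hint (by rw [hzero]; exact integrable_zero _ _ _)
  rw [← hinv, hzero]
  ext x
  simp [Real.fourierInv_eq]

open MeasureTheory Complex in
/-- For every `λ ∈ ℂ`, the only Schwartz solution of `−u″ + (x − λ)²u = 0` is `u ≡ 0`. -/
theorem linear_pencil_trivial_kernel (lam : ℂ) (u : SchwartzMap ℝ ℂ)
    (heq : ∀ x : ℝ, -(deriv (deriv (u : ℝ → ℂ)) x)
      + ((x : ℂ) - lam) ^ 2 * u x = 0) :
    u = 0 := by
  let g : ℝ → ℂ := fun x ↦ cexp (-(x - lam) ^ 2 / 2)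
  let v := SchwartzMap.derivCLM ℝ ℂ u
  have hu (x : ℝ) : HasDerivAt u (v x) x := u.differentiableAt.hasDerivAt
  have hv (x : ℝ) : HasDerivAt v ((x - lam) ^ 2 * u x) x := by
    have h : HasDerivAt v (deriv v x) x := v.differentiableAt.hasDerivAt
    have hvu : ⇑v = deriv u := funext fun y ↦ SchwartzMap.derivCLM_apply ℝ u y
    rw [hvu] at h ⊢
    convert h using 1
    linear_combination heq x
  have hid (x : ℝ) : HasDerivAt (fun y : ℝ ↦ (y : ℂ) - lam) 1 x :=
    ofRealCLM.hasDerivAt.sub_const lam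
  have hg (x : ℝ) : HasDerivAt g (-(x - lam) * g x) x := by
    convert (((hid x).fun_pow 2).fun_neg.div_const 2).cexp using 1
    simp only [g]
    push_cast
    ring
  have hgcont : Continuous g := by fun_prop
  have hgbound (x : ℝ) : ‖g x‖ ≤ Real.exp (lam.im ^ 2 / 2) := by
    rw [norm_exp, Real.exp_le_exp]
    have hre : (-((x : ℂ) - lam) ^ 2 / 2).re = (lam.im ^ 2 - (x - lam.re) ^ 2) / 2 := by
      rw [← ofReal_ofNat, div_ofReal_re]
      simp [pow_two]
    rw [hre]
    linarith [sq_nonneg (x - lam.re)]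
  have hmul {f : ℝ → ℂ} (hf : Integrable f) : Integrable fun x ↦ f x * g x :=
    hf.mul_bdd hgcont.aestronglyMeasurable (ae_of_all _ hgbound)
  have hxu : Integrable fun x : ℝ ↦ (x : ℂ) * u x := by
    refine (u.integrable_pow_mul volume 1).mono
      (continuous_ofReal.mul u.continuous).aestronglyMeasurable (ae_of_all _ fun x ↦ ?_)
    simp
  have hzero : (fun x ↦ u x * g x) = 0 := by
    refine eq_zero_of_hasDerivAt_deriv_add_mul lam (fun x ↦ (hu x).fun_mul (hg x)) (fun x ↦ ?_)
      (hmul u.integrable) ?_ ?_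
    · have hfun : (fun y : ℝ ↦ v y * g y + u y * (-(y - lam) * g y) +
          2 * (y - lam) * (u y * g y)) = fun y ↦ (v y + (y - lam) * u y) * g y := by
        ext y
        ring
      rw [hfun]
      refine (((hv x).fun_add ((hid x).fun_mul (hu x))).fun_mul (hg x)).congr_deriv ?_
      ring
    · convert hmul hxu using 2
      simp only [real_smul]
      ring
    · convert hmul ((v.integrable (μ := volume)).sub
        (hxu.sub ((u.integrable (μ := volume)).const_mul lam))) using 2
      simp only [Pi.sub_apply]
      ring
  ext x
  simpa [g, exp_ne_zero] using congrFun hzero x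
end

section
/- Let k ≥ 2 be an even integer and λ ∈ ℂ. If there exists a nonzero function u in the Schwartz space 𝒮(ℝ, ℂ) satisfying −u″(x) + (x^k − λ)²·u(x) = 0 for all x ∈ ℝ, then |arg λ| ≥ kπ/(2(k+1)). In other words, the set Sp[L_k] of eigenvalues of the pencil L_k(λ) = −d²/dx² + (x^k − λ)² is included in the two sectors {λ ∈ ℂ : |arg λ| ≥ kπ/(2(k+1))}. -/
open Real

/-- The coefficients decay faster than every geometric sequence. -/
def RapidDecay (c : ℕ → ℂ) : Prop :=
  ∀ r : ℝ, 0 < r → ∃ M : ℝ, ∀ n, ‖c n‖ * r ^ n ≤ M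

lemma RapidDecay.succ_mul {c : ℕ → ℂ} (hc : RapidDecay c) :
    RapidDecay fun n => ((n : ℂ) + 1) * c (n + 1) := by
  intro r hr
  obtain ⟨M, hM⟩ := hc (2 * r) (by positivity)
  refine ⟨M / r, fun n => ?_⟩
  rw [le_div_iff₀ hr]
  refine le_trans ?_ (hM (n + 1))
  have h1 : ((n : ℝ) + 1) ≤ 2 ^ (n + 1) := by
    exact_mod_cast (Nat.lt_two_pow_self (n := n + 1)).le
  have h2 : ‖(n : ℂ) + 1‖ = (n : ℝ) + 1 := by
    exact_mod_cast Complex.norm_natCast (n + 1)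
  rw [norm_mul, h2, mul_pow]
  calc ((n : ℝ) + 1) * ‖c (n + 1)‖ * r ^ n * r = ((n : ℝ) + 1) * (‖c (n + 1)‖ * r ^ (n + 1)) := by
        ring
    _ ≤ 2 ^ (n + 1) * (‖c (n + 1)‖ * r ^ (n + 1)) := by gcongr
    _ = _ := by ring

lemma RapidDecay.summable_norm {c : ℕ → ℂ} (hc : RapidDecay c) {r : ℝ} (hr : 0 ≤ r) :
    Summable fun n => ‖c n‖ * r ^ n := by
  obtain ⟨M, hM⟩ := hc (2 * (r + 1)) (by positivity)
  refine Summable.of_nonneg_of_le (fun n => by positivity) (fun n => ?_)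
    (summable_geometric_two.mul_left M)
  calc ‖c n‖ * r ^ n ≤ ‖c n‖ * (r + 1) ^ n := by gcongr; linarith
    _ = ‖c n‖ * (2 * (r + 1)) ^ n * (1 / 2) ^ n := by
        rw [mul_assoc, ← mul_pow]; congr 2; ring
    _ ≤ _ := by gcongr; exact hM n

lemma RapidDecay.summable {c : ℕ → ℂ} (hc : RapidDecay c) (z : ℂ) :
    Summable fun n => ‖c n * z ^ n‖ := by
  simpa [norm_mul, norm_pow] using hc.summable_norm (norm_nonneg z)

lemma RapidDecay.hasDerivAt {c : ℕ → ℂ} (hc : RapidDecay c) (z : ℂ) :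
    HasDerivAt (fun z => ∑' n, c n * z ^ n) (∑' n : ℕ, ((n : ℂ) + 1) * c (n + 1) * z ^ n) z := by
  set r : ℝ := ‖z‖ + 1
  have hr : 0 < r := by positivity
  have key : HasDerivAt (fun z => ∑' n, c n * z ^ n) (∑' n : ℕ, c n * (n * z ^ (n - 1))) z := by
    have h0 : Summable fun n => c n * (0 : ℂ) ^ n := (hc.summable 0).of_norm
    refine hasDerivAt_tsum_of_isPreconnected (g := fun n z => c n * z ^ n)
      (g' := fun n z => c n * (n * z ^ (n - 1))) (u := fun n => ‖c n‖ * (n * r ^ (n - 1)))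
      (t := Metric.ball 0 r) (y₀ := 0) ?_ Metric.isOpen_ball (convex_ball _ _).isPreconnected
      (fun n y _ => (hasDerivAt_pow n y).const_mul _) ?_ (by simpa using hr) h0
      (by simp [r])
    · rw [← summable_nat_add_iff 1]
      refine (hc.succ_mul.summable_norm hr.le).congr fun n => ?_
      have h2 : ‖(n : ℂ) + 1‖ = (n : ℝ) + 1 := by
        exact_mod_cast Complex.norm_natCast (n + 1)
      rw [norm_mul, h2]
      push_cast [add_tsub_cancel_right]
      ring
    · intro n y hy
      rw [norm_mul, norm_mul, norm_pow, Complex.norm_natCast]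
      have : ‖y‖ ≤ r := by simpa using (Metric.mem_ball.1 hy).le
      gcongr
  convert! key using 1
  have hs : Summable fun n : ℕ => c n * (n * z ^ (n - 1)) := by
    rw [← summable_nat_add_iff 1]
    refine (hc.succ_mul.summable z).of_norm.congr fun n => ?_
    push_cast [add_tsub_cancel_right]
    ring
  rw [hs.tsum_eq_zero_add]
  simp only [Nat.cast_zero, zero_mul, mul_zero, zero_add, add_tsub_cancel_right]
  refine tsum_congr fun n => ?_
  push_cast
  ring

/-- Taylor coefficients of the solution of `f'' = p f` with `f 0 = a`, `f' 0 = b`, where `p`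
has Taylor coefficients `p n`. -/
noncomputable def odeCoeff (p : ℕ → ℂ) (a b : ℂ) : ℕ → ℂ
  | 0 => a
  | 1 => b
  | n + 2 => (∑ j : Fin (n + 1), p j * odeCoeff p a b (n - j)) / ((n + 2) * (n + 1))

lemma odeCoeff_add_two (p : ℕ → ℂ) (a b : ℂ) (n : ℕ) :
    ((n : ℂ) + 1) * (((n : ℂ) + 2) * odeCoeff p a b (n + 2)) =
      ∑ ij ∈ Finset.HasAntidiagonal.antidiagonal n, p ij.1 * odeCoeff p a b ij.2 := by
  rw [Finset.Nat.sum_antidiagonal_eq_sum_range_succ (fun i j => p i * odeCoeff p a b j),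
    Finset.sum_range, odeCoeff]
  have h1 : (n : ℂ) + 1 ≠ 0 := by exact_mod_cast n.succ_ne_zero
  have h2 : (n : ℂ) + 2 ≠ 0 := by exact_mod_cast (n + 1).succ_ne_zero
  field_simp

lemma rapidDecay_odeCoeff {p : ℕ → ℂ} (hp : RapidDecay p) (a b : ℂ) :
    RapidDecay (odeCoeff p a b) := by
  intro r hr
  set c := odeCoeff p a b
  set S := ∑' j, ‖p j‖ * r ^ j
  have hsum := hp.summable_norm hr.le
  have hS : 0 ≤ S := tsum_nonneg fun j => by positivity
  obtain ⟨N, hN⟩ := exists_nat_ge (r ^ 2 * S)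
  set M := ∑ i ∈ Finset.range (N + 2), ‖c i‖ * r ^ i
  have hM : 0 ≤ M := Finset.sum_nonneg fun i _ => by positivity
  refine ⟨M, fun n => ?_⟩
  induction n using Nat.strong_induction_on with
  | _ n ih =>
  rcases lt_or_ge n (N + 2) with h | h
  · exact Finset.single_le_sum (f := fun i => ‖c i‖ * r ^ i) (fun i _ => by positivity)
      (Finset.mem_range.2 h)
  · obtain ⟨m, rfl⟩ : ∃ m, n = m + 2 := ⟨n - 2, by omega⟩
    have hm : (N : ℝ) ≤ m := by exact_mod_cast (by omega : N ≤ m)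
    have hb : ‖∑ ij ∈ Finset.HasAntidiagonal.antidiagonal m, p ij.1 * c ij.2‖ * r ^ m ≤ S * M := by
      calc _ ≤ (∑ ij ∈ Finset.HasAntidiagonal.antidiagonal m, ‖p ij.1‖ * ‖c ij.2‖) * r ^ m := by
            gcongr
            exact (norm_sum_le _ _).trans_eq (by simp)
        _ = ∑ ij ∈ Finset.HasAntidiagonal.antidiagonal m, ‖p ij.1‖ * r ^ ij.1 * (‖c ij.2‖ * r ^ ij.2) := by
            rw [Finset.sum_mul]
            refine Finset.sum_congr rfl fun ij hij => ?_
            rw [← Finset.HasAntidiagonal.mem_antidiagonal.1 hij, pow_add]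
            ring
        _ ≤ ∑ ij ∈ Finset.HasAntidiagonal.antidiagonal m, ‖p ij.1‖ * r ^ ij.1 * M := by
            refine Finset.sum_le_sum fun ij hij => ?_
            have := Finset.HasAntidiagonal.mem_antidiagonal.1 hij
            gcongr
            exact ih _ (by omega)
        _ = (∑ j ∈ Finset.range (m + 1), ‖p j‖ * r ^ j) * M := by
            rw [Finset.Nat.sum_antidiagonal_eq_sum_range_succ_mk, Finset.sum_mul]
        _ ≤ S * M := by
            gcongr
            exact hsum.sum_le_tsum _ fun i _ => by positivity
    rw [← odeCoeff_add_two, norm_mul, norm_mul] at hb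
    have h1 : ‖(m : ℂ) + 1‖ = (m : ℝ) + 1 := by exact_mod_cast Complex.norm_natCast (m + 1)
    have h2 : ‖(m : ℂ) + 2‖ = (m : ℝ) + 2 := by exact_mod_cast Complex.norm_natCast (m + 2)
    rw [h1, h2] at hb
    have hm0 : (0 : ℝ) ≤ m := m.cast_nonneg
    have hx : 0 ≤ ‖c (m + 2)‖ * r ^ (m + 2) := by positivity
    have h3 : ((m : ℝ) + 1) * (‖c (m + 2)‖ * r ^ (m + 2)) ≤ ((m : ℝ) + 1) * M := by
      calc ((m : ℝ) + 1) * (‖c (m + 2)‖ * r ^ (m + 2))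
          ≤ ((m : ℝ) + 2) * (((m : ℝ) + 1) * (‖c (m + 2)‖ * r ^ (m + 2))) := by
            nlinarith [mul_nonneg hm0 hx, mul_nonneg hm0 (mul_nonneg hm0 hx)]
        _ = r ^ 2 * (((m : ℝ) + 1) * (((m : ℝ) + 2) * ‖c (m + 2)‖) * r ^ m) := by ring
        _ ≤ r ^ 2 * (S * M) := by gcongr
        _ = r ^ 2 * S * M := by ring
        _ ≤ ((m : ℝ) + 1) * M := by gcongr; linarith
    exact le_of_mul_le_mul_left h3 (by positivity)

/-- The linear equation `f'' = P f` with polynomial `P` has entire solutions with arbitrary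
initial data. -/
theorem exists_entire_solution (P : Polynomial ℂ) (a b : ℂ) :
    ∃ f g : ℂ → ℂ, f 0 = a ∧ g 0 = b ∧ (∀ z, HasDerivAt f (g z) z) ∧
      ∀ z, HasDerivAt g (P.eval z * f z) z := by
  have hev : ∀ z, P.eval z = ∑' n, P.coeff n * z ^ n := fun z => by
    rw [Polynomial.eval_eq_sum_range, tsum_eq_sum]
    intro n hn
    rw [Polynomial.coeff_eq_zero_of_natDegree_lt (by simpa using hn), zero_mul]
  have hP : RapidDecay P.coeff := fun r hr => by
    refine ⟨∑ i ∈ Finset.range (P.natDegree + 1), ‖P.coeff i‖ * r ^ i, fun n => ?_⟩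
    rcases lt_or_ge n (P.natDegree + 1) with h | h
    · exact Finset.single_le_sum (f := fun i => ‖P.coeff i‖ * r ^ i) (fun i _ => by positivity)
        (Finset.mem_range.2 h)
    · rw [Polynomial.coeff_eq_zero_of_natDegree_lt (by omega), norm_zero, zero_mul]
      exact Finset.sum_nonneg fun i _ => by positivity
  set c := odeCoeff P.coeff a b
  have hc : RapidDecay c := rapidDecay_odeCoeff hP a b
  refine ⟨_, _, ?_, ?_, hc.hasDerivAt, fun z => ?_⟩
  · rw [tsum_eq_single 0 fun n hn => by simp [hn]]
    simp [c, odeCoeff]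
  · rw [tsum_eq_single 0 fun n hn => by simp [hn]]
    simp [c, odeCoeff]
  · convert! hc.succ_mul.hasDerivAt z using 1
    rw [hev, tsum_mul_tsum_eq_tsum_sum_antidiagonal_of_summable_norm (hP.summable z)
      (hc.summable z)]
    refine tsum_congr fun n => ?_
    have := odeCoeff_add_two P.coeff a b n
    push_cast
    rw [show (n : ℂ) + 1 + 1 = n + 2 by ring, this, Finset.sum_mul]
    refine Finset.sum_congr rfl fun ij hij => ?_
    rw [← Finset.HasAntidiagonal.mem_antidiagonal.1 hij, pow_add]
    ring

/-- Uniqueness for the second order linear equation `y'' = q y` on the real line. -/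
theorem eq_of_second_order {q y₁ v₁ y₂ v₂ : ℝ → ℂ} (hq : Continuous q)
    (hy₁ : ∀ t, HasDerivAt y₁ (v₁ t) t) (hv₁ : ∀ t, HasDerivAt v₁ (q t * y₁ t) t)
    (hy₂ : ∀ t, HasDerivAt y₂ (v₂ t) t) (hv₂ : ∀ t, HasDerivAt v₂ (q t * y₂ t) t)
    {t₀ : ℝ} (h0 : y₁ t₀ = y₂ t₀) (h1 : v₁ t₀ = v₂ t₀) (t : ℝ) :
    y₁ t = y₂ t ∧ v₁ t = v₂ t := by
  set A := min (-|t|) (-|t₀|) - 1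
  set B := max |t| |t₀| + 1
  have ht : t ∈ Set.Ioo A B := by simp only [A, B]; grind
  have ht₀ : t₀ ∈ Set.Ioo A B := by simp only [A, B]; grind
  obtain ⟨C, hC⟩ := isCompact_Icc.exists_bound_of_continuousOn (s := Set.Icc A B) hq.continuousOn
  have h := ODE_solution_unique_of_mem_Ioo (v := fun t (y : ℂ × ℂ) => (y.2, q t * y.1))
    (s := fun _ => Set.univ) (K := (max 1 C).toNNReal) (f := fun t => (y₁ t, v₁ t))
    (g := fun t => (y₂ t, v₂ t)) (a := A) (b := B) (t₀ := t₀) ?_ ht₀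
    (fun s _ => ⟨(hy₁ s).prodMk (hv₁ s), trivial⟩) (fun s _ => ⟨(hy₂ s).prodMk (hv₂ s), trivial⟩)
    (by simp [h0, h1]) ht
  · simp at h
    exact h
  · intro s hs
    refine LipschitzOnWith.of_dist_le_mul fun x _ y _ => ?_
    rw [Real.coe_toNNReal _ (le_max_of_le_left zero_le_one), dist_eq_norm, dist_eq_norm,
      Prod.norm_def, Prod.norm_def]
    have h1 : ‖(x - y).1‖ ≤ max ‖(x - y).1‖ ‖(x - y).2‖ := le_max_left _ _
    have h2 : ‖(x - y).2‖ ≤ max ‖(x - y).1‖ ‖(x - y).2‖ := le_max_right _ _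
    have hm : 0 ≤ max ‖(x - y).1‖ ‖(x - y).2‖ := (norm_nonneg _).trans h1
    refine max_le ?_ ?_
    · calc ‖x.2 - y.2‖ ≤ 1 * max ‖(x - y).1‖ ‖(x - y).2‖ := by rw [one_mul]; exact h2
        _ ≤ _ := by gcongr; exact le_max_left _ _
    · calc ‖q s * x.1 - q s * y.1‖ = ‖q s‖ * ‖(x - y).1‖ := by
            rw [← mul_sub, norm_mul, Prod.fst_sub]
        _ ≤ max 1 C * max ‖(x - y).1‖ ‖(x - y).2‖ := by
            gcongr
            exact (hC s ⟨hs.1.le, hs.2.le⟩).trans (le_max_right _ _)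

section Energy

variable {Q f g : ℂ → ℂ}

lemma hasDerivAt_energy (hf : ∀ z, HasDerivAt f (g z) z) (hg : ∀ z, HasDerivAt g (Q z * f z) z)
    (w z₀ d : ℂ) (t : ℝ) :
    HasDerivAt (fun t : ℝ => (w * star (f (z₀ + t * d)) * g (z₀ + t * d)).re)
      ((w * star d).re * ‖g (z₀ + t * d)‖ ^ 2
        + (w * (d * Q (z₀ + t * d))).re * ‖f (z₀ + t * d)‖ ^ 2) t := by
  have hl : HasDerivAt (fun t : ℝ => z₀ + t * d) d t := by
    simpa using ((Complex.ofRealCLM.hasDerivAt (x := t)).mul_const d).const_add z₀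
  have hf' := (hf (z₀ + t * d)).comp t hl
  have hg' := (hg (z₀ + t * d)).comp t hl
  have h := Complex.reCLM.hasFDerivAt.comp_hasDerivAt t ((hf'.star.const_mul w).mul hg')
  convert! h using 1
  set F := f (z₀ + t * d)
  set G := g (z₀ + t * d)
  set q := Q (z₀ + t * d)
  simp only [Function.comp_apply, Complex.reCLM_apply, star_mul']
  rw [← Complex.re_mul_ofReal, ← Complex.re_mul_ofReal, ← Complex.add_re]
  congr 1
  push_cast
  rw [← Complex.mul_conj', ← Complex.mul_conj']
  simp only [← starRingEnd_apply]
  ring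

lemma energy_le_energy (hf : ∀ z, HasDerivAt f (g z) z)
    (hg : ∀ z, HasDerivAt g (Q z * f z) z) (w z₀ d : ℂ) {T : ℝ} (hT : 0 ≤ T)
    (hd : 0 ≤ (w * star d).re) (hQ : ∀ t : ℝ, 0 ≤ t → t ≤ T → 0 ≤ (w * (d * Q (z₀ + t * d))).re) :
    (w * star (f z₀) * g z₀).re ≤ (w * star (f (z₀ + T * d)) * g (z₀ + T * d)).re := by
  have hder := hasDerivAt_energy hf hg w z₀ d
  have hmono := monotoneOn_of_hasDerivWithinAt_nonneg (convex_Icc 0 T)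
    (fun t _ => (hder t).continuousAt.continuousWithinAt)
    (fun t _ => (hder t).hasDerivWithinAt) (fun t ht => by
      have ht' := interior_subset ht
      have := hQ t ht'.1 ht'.2
      positivity)
  simpa using hmono (Set.left_mem_Icc.2 hT) (Set.right_mem_Icc.2 hT) hT

end Energy

lemma re_exp_mul_sub_sq (r m a b φ : ℝ) :
    (Complex.exp (-b * Complex.I) * (Complex.exp (φ * Complex.I) *
      (r * Complex.exp (a * Complex.I) - m * Complex.exp (b * Complex.I)) ^ 2)).re =
      r ^ 2 * cos (2 * a + φ - b) - 2 * m * r * cos (a + φ) + m ^ 2 * cos (b + φ) := by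
  have key : Complex.exp (-b * Complex.I) * (Complex.exp (φ * Complex.I) *
      (r * Complex.exp (a * Complex.I) - m * Complex.exp (b * Complex.I)) ^ 2) =
      ((r ^ 2 : ℝ) : ℂ) * Complex.exp ((2 * a + φ - b : ℝ) * Complex.I)
        - ((2 * m * r : ℝ) : ℂ) * Complex.exp ((a + φ : ℝ) * Complex.I)
        + ((m ^ 2 : ℝ) : ℂ) * Complex.exp ((b + φ : ℝ) * Complex.I) := by
    have hb := Complex.exp_ne_zero (b * Complex.I)
    have h1 : Complex.exp ((2 * a + φ - b : ℝ) * Complex.I) = Complex.exp (a * Complex.I) ^ 2 *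
        Complex.exp (φ * Complex.I) * (Complex.exp (b * Complex.I))⁻¹ := by
      rw [← Complex.exp_nat_mul, ← Complex.exp_neg, ← Complex.exp_add, ← Complex.exp_add]
      push_cast
      ring_nf
    have h2 : Complex.exp ((a + φ : ℝ) * Complex.I) =
        Complex.exp (a * Complex.I) * Complex.exp (φ * Complex.I) := by
      rw [← Complex.exp_add]
      push_cast
      ring_nf
    have h3 : Complex.exp ((b + φ : ℝ) * Complex.I) =
        Complex.exp (b * Complex.I) * Complex.exp (φ * Complex.I) := by
      rw [← Complex.exp_add]
      push_cast
      ring_nf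
    rw [h1, h2, h3, neg_mul, Complex.exp_neg]
    push_cast
    field_simp
    ring
  rw [key, Complex.add_re, Complex.sub_re, Complex.re_ofReal_mul, Complex.re_ofReal_mul,
    Complex.re_ofReal_mul, Complex.exp_ofReal_mul_I_re, Complex.exp_ofReal_mul_I_re,
    Complex.exp_ofReal_mul_I_re]

lemma cos_pos_of_abs_lt {x : ℝ} (hx : |x| < π / 2) : 0 < cos x :=
  cos_pos_of_mem_Ioo ⟨(abs_lt.1 hx).1, (abs_lt.1 hx).2⟩

lemma exists_radius_pos {k : ℕ} (hk : k ≠ 0) {m A : ℝ} (hm : 0 ≤ m) (hA : |A| < π / 2) :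
    ∃ R : ℝ, 0 < R ∧ ∀ ρ : ℝ, R ≤ ρ → ∀ a b φ : ℝ, |2 * a + φ - b| ≤ |A| →
      0 < (Complex.exp (-b * Complex.I) * (Complex.exp (φ * Complex.I) *
        (((ρ ^ k : ℝ) : ℂ) * Complex.exp (a * Complex.I)
          - m * Complex.exp (b * Complex.I)) ^ 2)).re := by
  have hc := cos_pos_of_abs_lt hA
  refine ⟨1 + (2 * m + m ^ 2) / cos A, by positivity, fun ρ hρ a b φ h => ?_⟩
  rw [re_exp_mul_sub_sq]
  have hρ1 : 1 ≤ ρ := le_trans (by linarith [show 0 ≤ (2 * m + m ^ 2) / cos A by positivity]) hρ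
  set r := ρ ^ k
  have hr : ρ ≤ r := le_self_pow₀ hρ1 hk
  have hr1 : 1 ≤ r := hρ1.trans hr
  have hcos : cos A ≤ cos (2 * a + φ - b) := by
    rw [← cos_abs A, ← cos_abs (2 * a + φ - b)]
    exact cos_le_cos_of_nonneg_of_le_pi (abs_nonneg _) (by linarith [pi_pos]) h
  have hbig : 2 * m + m ^ 2 < cos A * r := by
    have : (1 + (2 * m + m ^ 2) / cos A) * cos A ≤ r * cos A := by gcongr; linarith
    rw [add_mul, div_mul_cancel₀ _ hc.ne'] at this
    linarith
  have h1 : 2 * m * r * cos (a + φ) ≤ 2 * m * r :=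
    mul_le_of_le_one_right (by positivity) (cos_le_one _)
  have h2 : -m ^ 2 ≤ m ^ 2 * cos (b + φ) := by nlinarith [neg_one_le_cos (b + φ), sq_nonneg m]
  have h3 : r ^ 2 * cos A ≤ r ^ 2 * cos (2 * a + φ - b) := by gcongr
  have h4 : r * (2 * m + m ^ 2) < r * (cos A * r) := by gcongr
  nlinarith [mul_nonneg (sq_nonneg m) (sub_nonneg.2 hr1)]

/-- Points of the segment from `R exp (iθ)` to `2 R cos θ`, in polar form. -/
lemma exists_polar_segment {θ R t : ℝ} (hθ : |θ| ≤ π / 4) (hR : 0 < R) (ht : 0 ≤ t)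
    (htR : t ≤ R) : ∃ ρ β : ℝ, R ≤ ρ ∧ |2 * β - θ| ≤ |θ| ∧
      (R : ℂ) * Complex.exp (θ * Complex.I) + t * Complex.exp (-θ * Complex.I) =
        ρ * Complex.exp (β * Complex.I) := by
  wlog h0 : 0 ≤ θ generalizing θ
  · obtain ⟨ρ, β, h1, h2, h3⟩ := this (θ := -θ) (by rwa [abs_neg]) (by linarith)
    refine ⟨ρ, -β, h1, ?_, ?_⟩
    · rw [abs_neg] at h2
      rwa [← abs_neg, show -(2 * -β - θ) = 2 * β - -θ by ring]
    · have := congrArg (starRingEnd ℂ) h3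
      simpa [← Complex.exp_conj] using this
  rw [abs_of_nonneg h0] at hθ ⊢
  have hpi := pi_pos
  set z : ℂ := (R : ℂ) * Complex.exp (θ * Complex.I) + t * Complex.exp (-θ * Complex.I)
  have hexp : (-θ : ℂ) = ((-θ : ℝ) : ℂ) := by push_cast; rfl
  have hre : z.re = (R + t) * cos θ := by
    simp only [z, hexp, Complex.add_re, Complex.re_ofReal_mul, Complex.exp_ofReal_mul_I_re, cos_neg]
    ring
  have him : z.im = (R - t) * sin θ := by
    simp only [z, hexp, Complex.add_im, Complex.im_ofReal_mul, Complex.exp_ofReal_mul_I_im, sin_neg]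
    ring
  have hcos : 0 < cos θ := cos_pos_of_mem_Ioo ⟨by linarith, by linarith⟩
  have hsin : 0 ≤ sin θ := sin_nonneg_of_nonneg_of_le_pi h0 (by linarith)
  have hcos2 : 0 ≤ cos (2 * θ) := cos_nonneg_of_mem_Icc ⟨by linarith, by linarith⟩
  have harg0 : 0 ≤ z.arg := by
    rw [Complex.arg_nonneg_iff, him]
    exact mul_nonneg (by linarith) hsin
  have hnorm : R ≤ ‖z‖ := by
    refine le_of_sq_le_sq ?_ (norm_nonneg z)
    rw [← Complex.normSq_eq_norm_sq, Complex.normSq_apply, hre, him]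
    rw [cos_two_mul] at hcos2
    have := sin_sq_add_cos_sq θ
    have heq : (R + t) * cos θ * ((R + t) * cos θ) + (R - t) * sin θ * ((R - t) * sin θ) =
        R ^ 2 + t ^ 2 + 2 * (R * t * (2 * cos θ ^ 2 - 1)) := by
      linear_combination (R - t) ^ 2 * this
    rw [heq]
    linarith [mul_nonneg (mul_nonneg hR.le ht) hcos2, sq_nonneg t]
  have hzpos : 0 < ‖z‖ := hR.trans_le hnorm
  have hargle : z.arg ≤ θ := by
    by_contra! hlt
    have hneg : sin (θ - z.arg) < 0 :=
      sin_neg_of_neg_of_neg_pi_lt (by linarith) (by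
        have := (abs_lt.1 (Complex.abs_arg_lt_pi_div_two_iff.2
          (Or.inl (by rw [hre]; positivity)))).2
        linarith)
    rw [sin_sub, Complex.cos_arg (norm_pos_iff.1 hzpos), Complex.sin_arg, hre, him] at hneg
    have : sin θ * ((R + t) * cos θ / ‖z‖) - cos θ * ((R - t) * sin θ / ‖z‖) =
        2 * t * sin θ * cos θ / ‖z‖ := by ring
    rw [this] at hneg
    exact absurd hneg (not_lt.2 (by positivity))
  refine ⟨‖z‖, z.arg, hnorm, abs_le.2 ⟨by linarith, by linarith⟩, ?_⟩
  exact (Complex.norm_mul_exp_arg_mul_I z).symm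

lemma ofReal_mul_exp_pow (ρ β : ℝ) (k : ℕ) :
    ((ρ : ℂ) * Complex.exp (β * Complex.I)) ^ k =
      ((ρ ^ k : ℝ) : ℂ) * Complex.exp ((k * β : ℝ) * Complex.I) := by
  rw [mul_pow, ← Complex.exp_nat_mul]
  push_cast
  ring_nf

lemma re_exp_mul_star_exp (b φ : ℝ) :
    (Complex.exp (-b * Complex.I) * star (Complex.exp (φ * Complex.I))).re = cos (b + φ) := by
  rw [← starRingEnd_apply, ← Complex.exp_conj, ← Complex.exp_add, ← cos_neg,
    ← Complex.exp_ofReal_mul_I_re]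
  simp only [map_mul, Complex.conj_ofReal, Complex.conj_I]
  push_cast
  ring_nf

/-- If the energy of a solution tends to zero at `+∞`, then the energy at the origin is bounded
by the energy far out on the positive axis, which is nonpositive. -/
theorem energy_zero_le {k : ℕ} (hk : 2 ≤ k) {m θ : ℝ} (hm : 0 ≤ m)
    (hθ : |((k : ℝ) + 1) * θ| < π / 2) :
    ∃ X : ℝ, ∀ f g : ℂ → ℂ, (∀ z, HasDerivAt f (g z) z) →
      (∀ z, HasDerivAt g
        ((z ^ k - m * Complex.exp ((k * θ : ℝ) * Complex.I)) ^ 2 * f z) z) →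
      Filter.Tendsto (fun x : ℝ =>
        (Complex.exp (-(k * θ : ℝ) * Complex.I) * star (f x) * g x).re) Filter.atTop (nhds 0) →
      ∀ x : ℝ, X ≤ x →
        0 < (Complex.exp (-(k * θ : ℝ) * Complex.I) *
          ((x : ℂ) ^ k - m * Complex.exp ((k * θ : ℝ) * Complex.I)) ^ 2).re ∧
        (Complex.exp (-(k * θ : ℝ) * Complex.I) * star (f 0) * g 0).re ≤
          (Complex.exp (-(k * θ : ℝ) * Complex.I) * star (f x) * g x).re ∧
        (Complex.exp (-(k * θ : ℝ) * Complex.I) * star (f x) * g x).re ≤ 0 := by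
  obtain ⟨R, hR, hpos⟩ := exists_radius_pos (k := k) (by omega) hm hθ
  have hk' : (2 : ℝ) ≤ k := by exact_mod_cast hk
  have hA : |((k : ℝ) + 1) * θ| = (k + 1) * |θ| := by rw [abs_mul, abs_of_nonneg (by positivity)]
  have hkθ : |k * θ| ≤ |((k : ℝ) + 1) * θ| := by
    rw [hA, abs_mul, Nat.abs_cast]
    nlinarith [abs_nonneg θ]
  have hθ4 : |θ| ≤ π / 4 := by rw [hA] at hθ; nlinarith [abs_nonneg θ]
  have hcosθ : 0 < cos θ := cos_pos_of_abs_lt (by linarith [pi_pos])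
  have hcosk : 0 < cos (k * θ) := cos_pos_of_abs_lt (by linarith)
  refine ⟨2 * R, fun f g hf hg hlim => ?_⟩
  set w := Complex.exp (-(k * θ : ℝ) * Complex.I) with hw
  set lam := (m : ℂ) * Complex.exp ((k * θ : ℝ) * Complex.I) with hlam
  have hreal : ∀ x : ℝ, R ≤ x → 0 < (w * ((x : ℂ) ^ k - lam) ^ 2).re := fun x hx => by
    have h := hpos x hx 0 (k * θ) 0 (by
      rwa [mul_zero, add_zero, zero_sub, abs_neg])
    simpa only [Complex.ofReal_zero, zero_mul, Complex.exp_zero, mul_one, one_mul,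
      Complex.ofReal_pow] using h
  have hreal_le : ∀ x y : ℝ, R ≤ x → x ≤ y →
      (w * star (f x) * g x).re ≤ (w * star (f y) * g y).re := fun x y hx hxy => by
    have h := energy_le_energy hf hg w x 1 (T := y - x) (by linarith) (by
      have := re_exp_mul_star_exp (k * θ) 0
      simp only [Complex.ofReal_zero, zero_mul, Complex.exp_zero, add_zero] at this
      rw [this]
      exact hcosk.le) (fun t ht _ => by
        simpa using (hreal (x + t) (by linarith)).le)
    simpa using h
  have hray : (w * star (f 0) * g 0).re ≤
      (w * star (f (R * Complex.exp (θ * Complex.I))) * g (R * Complex.exp (θ * Complex.I))).re := by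
    have h := energy_le_energy hf hg w 0 (Complex.exp (θ * Complex.I)) hR.le (by
      rw [re_exp_mul_star_exp, show k * θ + θ = (k + 1) * θ by ring]
      exact (cos_pos_of_abs_lt hθ).le) (fun t ht _ => by
        rw [zero_add, ofReal_mul_exp_pow, re_exp_mul_sub_sq,
          show 2 * (k * θ) + θ - k * θ = (k + 1) * θ by ring,
          show k * θ + θ = (k + 1) * θ by ring]
        nlinarith [mul_nonneg (cos_pos_of_abs_lt hθ).le (sq_nonneg (t ^ k - m))])
    simpa using h
  have hcorner : (R : ℂ) * Complex.exp (θ * Complex.I) + R * Complex.exp ((-θ : ℝ) * Complex.I) =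
      ((2 * R * cos θ : ℝ) : ℂ) := by
    apply Complex.ext
    · simp only [Complex.add_re, Complex.re_ofReal_mul, Complex.exp_ofReal_mul_I_re, cos_neg,
        Complex.ofReal_re]
      ring
    · simp only [Complex.add_im, Complex.im_ofReal_mul, Complex.exp_ofReal_mul_I_im, sin_neg,
        Complex.ofReal_im]
      ring
  have hseg := energy_le_energy hf hg w (R * Complex.exp (θ * Complex.I))
    (Complex.exp ((-θ : ℝ) * Complex.I)) hR.le (by
      rw [re_exp_mul_star_exp]
      refine (cos_pos_of_abs_lt (lt_of_le_of_lt ?_ hθ)).le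
      rw [hA, show k * θ + -θ = (k - 1) * θ by ring, abs_mul, abs_of_nonneg (by linarith)]
      nlinarith [abs_nonneg θ]) (fun t ht htR => by
      obtain ⟨ρ, β, hρ, hβ, hz⟩ := exists_polar_segment hθ4 hR ht htR
      rw [← Complex.ofReal_neg] at hz
      rw [hz, ofReal_mul_exp_pow]
      refine (hpos ρ hρ (k * β) (k * θ) (-θ) ?_).le
      rw [show 2 * (k * β) + -θ - k * θ = k * (2 * β - θ) + -θ by ring]
      calc |k * (2 * β - θ) + -θ| ≤ |k * (2 * β - θ)| + |-θ| := abs_add_le _ _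
        _ ≤ k * |θ| + |θ| := by
            rw [abs_mul, Nat.abs_cast, abs_neg]
            gcongr
        _ = _ := by rw [hA]; ring)
  rw [hcorner] at hseg
  have hRc : R ≤ 2 * R * cos θ := by
    have : 1 / 2 ≤ cos θ := by
      rw [← cos_pi_div_three, ← cos_abs θ]
      exact cos_le_cos_of_nonneg_of_le_pi (abs_nonneg _) (by linarith [pi_pos])
        (by linarith [pi_pos])
    nlinarith
  have hRc' : 2 * R * cos θ ≤ 2 * R := mul_le_of_le_one_right (by positivity) (cos_le_one θ)
  intro x hx
  refine ⟨hreal x (by linarith), ?_, ?_⟩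
  · exact (hray.trans hseg).trans (hreal_le _ _ hRc (by linarith))
  · refine ge_of_tendsto hlim ?_
    filter_upwards [Filter.eventually_ge_atTop x] with y hy
    exact hreal_le x y (by linarith) hy

/-- For even `k ≥ 2`, every eigenvalue `λ` of the pencil `L_k(λ) = −d²/dx² + (x^k − λ)²`
(i.e. every `λ` for which there is a nonzero Schwartz solution of `L_k(λ)u = 0`)
satisfies `|arg λ| ≥ kπ/(2(k+1))`. -/
theorem spectrum_in_sectors (k : ℕ) (hk : 2 ≤ k) (hkeven : Even k) (lam : ℂ)
    (hex : ∃ u : SchwartzMap ℝ ℂ, u ≠ 0 ∧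
      ∀ x : ℝ, -(deriv (deriv (u : ℝ → ℂ)) x)
        + ((x : ℂ) ^ k - lam) ^ 2 * u x = 0) :
    (k : ℝ) * π / (2 * ((k : ℝ) + 1)) ≤ |lam.arg| := by
  by_contra! hlt
  obtain ⟨u, hu0, hu⟩ := hex
  apply hu0
  have hk0 : (0 : ℝ) < k := by exact_mod_cast (by omega : 0 < k)
  set θ : ℝ := lam.arg / k
  have hθ : |((k : ℝ) + 1) * θ| < π / 2 := by
    rw [abs_mul, abs_div, Nat.abs_cast, abs_of_nonneg (by positivity : (0 : ℝ) ≤ k + 1),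
      ← mul_div_assoc, div_lt_iff₀ hk0]
    rw [lt_div_iff₀ (by positivity)] at hlt
    linarith
  have hlam : lam = (‖lam‖ : ℂ) * Complex.exp ((k * θ : ℝ) * Complex.I) := by
    rw [mul_div_cancel₀ _ hk0.ne']
    exact (Complex.norm_mul_exp_arg_mul_I lam).symm
  set w := Complex.exp (-(k * θ : ℝ) * Complex.I) with hw
  obtain ⟨f, g, hf0, hg0, hf, hg⟩ := exists_entire_solution
    ((Polynomial.X ^ k - Polynomial.C lam) ^ 2) (u 0) (deriv u 0)
  simp only [Polynomial.eval_pow, Polynomial.eval_sub, Polynomial.eval_X, Polynomial.eval_C] at hg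
  have hu1 : ∀ x, HasDerivAt u (deriv u x) x := fun x => u.differentiable.differentiableAt.hasDerivAt
  set u' := SchwartzMap.derivCLM ℂ ℂ u
  have hu' : ∀ x, u' x = deriv u x := SchwartzMap.derivCLM_apply ℂ u
  have hu2 : ∀ x : ℝ, HasDerivAt (deriv u) (((x : ℂ) ^ k - lam) ^ 2 * u x) x := fun x => by
    have h := (u'.differentiable x).hasDerivAt
    rw [show (u' : ℝ → ℂ) = deriv u from funext hu'] at h
    rwa [show ((x : ℂ) ^ k - lam) ^ 2 * u x = deriv (deriv u) x by linear_combination hu x]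
  have hq : Continuous fun x : ℝ => ((x : ℂ) ^ k - lam) ^ 2 := by fun_prop
  have hfu := eq_of_second_order (t₀ := 0) hq (fun x => (hf x).comp_ofReal)
    (fun x => (hg x).comp_ofReal) hu1 hu2 (by simpa using hf0) (by simpa using hg0)
  have hlim : Filter.Tendsto (fun x : ℝ => (w * star (f x) * g x).re) (Filter.cocompact ℝ)
      (nhds 0) := by
    have h1 : Filter.Tendsto u (Filter.cocompact ℝ) (nhds 0) := u.toZeroAtInfty.zero_at_infty'
    have h2 : Filter.Tendsto u' (Filter.cocompact ℝ) (nhds 0) := u'.toZeroAtInfty.zero_at_infty'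
    have h3 := (Complex.continuous_re.tendsto _).comp ((h1.star.const_mul w).mul h2)
    simp only [star_zero, mul_zero, Complex.zero_re] at h3
    refine h3.congr fun x => ?_
    simp only [Function.comp_apply, (hfu x).1, (hfu x).2, hu' x]
  obtain ⟨X, hX⟩ := energy_zero_le hk (norm_nonneg lam) hθ
  rw [← hlam, ← hw] at hX
  have hright := hX f g hf hg (hlim.mono_left atTop_le_cocompact)
  have hleft := hX (fun z => f (-z)) (fun z => -g (-z))
    (fun z => ((hf (-z)).comp z (hasDerivAt_neg z)).congr_deriv (by ring))
    (fun z => ((hg (-z)).comp z (hasDerivAt_neg z)).neg.congr_deriv (by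
      rw [hkeven.neg_pow]
      ring))
    (by
      have h := ((hlim.mono_left atBot_le_cocompact).comp Filter.tendsto_neg_atTop_atBot).neg
      rw [neg_zero] at h
      refine h.congr fun x => ?_
      simp only [Function.comp_apply, Complex.ofReal_neg, mul_neg, Complex.neg_re])
  have h0 : (w * star (f 0) * g 0).re = 0 := by
    obtain ⟨-, h1, h2⟩ := hright X le_rfl
    obtain ⟨-, h3, h4⟩ := hleft X le_rfl
    have h5 := h3.trans h4
    simp only [neg_zero, mul_neg, Complex.neg_re] at h5
    linarith
  have hzero : ∀ x : ℝ, X ≤ x → (w * star (f x) * g x).re = 0 := fun x hx => by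
    obtain ⟨-, h1, h2⟩ := hright x hx
    linarith
  have hpos := (hright (X + 1) (by linarith)).1
  have hder := hasDerivAt_energy hf hg w 0 1 (X + 1)
  have hconst : HasDerivAt (fun t : ℝ => (w * star (f (0 + t * 1)) * g (0 + t * 1)).re) 0
      (X + 1) := by
    refine (hasDerivAt_const (X + 1) (0 : ℝ)).congr_of_eventuallyEq ?_
    filter_upwards [eventually_ge_nhds (show X < X + 1 by linarith)] with t ht
    simpa using hzero t ht
  have hE := hder.unique hconst
  have hcosk : 0 < w.re := by
    have h := re_exp_mul_star_exp (k * θ) 0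
    simp only [Complex.ofReal_zero, zero_mul, Complex.exp_zero, add_zero, star_one, mul_one] at h
    rw [hw, h]
    refine cos_pos_of_abs_lt (lt_of_le_of_lt ?_ hθ)
    rw [abs_mul, abs_mul, Nat.abs_cast, abs_of_nonneg (by positivity : (0 : ℝ) ≤ k + 1)]
    gcongr
    linarith
  simp only [zero_add, mul_one, one_mul, star_one] at hE
  have hgz : g ((X + 1 : ℝ) : ℂ) = 0 := by
    by_contra hne
    have : 0 < ‖g ((X + 1 : ℝ) : ℂ)‖ := norm_pos_iff.2 hne
    have : 0 < w.re * ‖g ((X + 1 : ℝ) : ℂ)‖ ^ 2 := by positivity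
    nlinarith [mul_nonneg hpos.le (sq_nonneg ‖f ((X + 1 : ℝ) : ℂ)‖)]
  have hfz : f ((X + 1 : ℝ) : ℂ) = 0 := by
    by_contra hne
    have : 0 < ‖f ((X + 1 : ℝ) : ℂ)‖ := norm_pos_iff.2 hne
    have := mul_pos hpos (pow_pos this 2)
    rw [hgz] at hE
    simp only [norm_zero] at hE
    linarith
  ext x
  refine (eq_of_second_order (t₀ := X + 1) hq hu1 hu2 (y₂ := fun _ => 0) (v₂ := fun _ => 0)
    (fun t => hasDerivAt_const t 0) (fun t => by simpa using hasDerivAt_const t (0 : ℂ)) ?_ ?_ x).1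
  · rw [← (hfu _).1, hfz]
  · rw [← (hfu _).2, hgz]
end

section
/- Let 0 ≤ α < π/2 and let n be a natural number. Then there exists a nonzero function u in the Schwartz space 𝒮(ℝ, ℂ) such that −u″(x) + e^{iα}·x²·u(x) = e^{iα/2}·(2n+1)·u(x) for all x ∈ ℝ. That is, the complex numbers e^{iα/2}(2n+1), n = 0, 1, 2, …, are eigenvalues of the rotated harmonic oscillator −d²/dx² + e^{iα}x². -/
open Real

open Polynomial in
/-- The Hermite-type polynomials adapted to the Gaussian `exp (-b x² / 2)`. -/
noncomputable def rotatedHermite (b : ℂ) : ℕ → ℂ[X]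
  | 0 => 1
  | n + 1 => C (2 * b) * X * rotatedHermite b n - derivative (rotatedHermite b n)

open Polynomial in
theorem rotatedHermite_ode (b : ℂ) (n : ℕ) :
    derivative (derivative (rotatedHermite b n))
      = C (2 * b) * X * derivative (rotatedHermite b n) - C (2 * b * n) * rotatedHermite b n := by
  induction n with
  | zero => simp [rotatedHermite]
  | succ n ih =>
    have h : derivative (rotatedHermite b (n + 1))
        = C (2 * b * (n + 1 : ℕ)) * rotatedHermite b n := by
      simp only [rotatedHermite, derivative_sub, ih, derivative_mul, derivative_C, derivative_X,
        map_mul, Nat.cast_add, map_add, Nat.cast_one, map_one]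
      ring
    rw [h, derivative_C_mul, rotatedHermite]
    ring

open Polynomial in
theorem derivative_rotatedHermite_succ (b : ℂ) (n : ℕ) :
    derivative (rotatedHermite b (n + 1)) = C (2 * b * (n + 1 : ℕ)) * rotatedHermite b n := by
  simp only [rotatedHermite, derivative_sub, rotatedHermite_ode, derivative_mul, derivative_C,
    derivative_X, map_mul, Nat.cast_add, map_add, Nat.cast_one, map_one]
  ring

open Polynomial in
theorem rotatedHermite_ne_zero {b : ℂ} (hb : b ≠ 0) (n : ℕ) : rotatedHermite b n ≠ 0 := by
  induction n with
  | zero => simp [rotatedHermite]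
  | succ n ih =>
    intro h
    have h' := derivative_rotatedHermite_succ b n
    rw [h, derivative_zero, eq_comm, mul_eq_zero, C_eq_zero] at h'
    exact h'.elim (mul_ne_zero (mul_ne_zero two_ne_zero hb) (Nat.cast_ne_zero.2 n.succ_ne_zero)) ih

open Polynomial in
theorem hasDerivAt_polynomial_mul_gaussian (b : ℂ) (P : ℂ[X]) (x : ℝ) :
    HasDerivAt (fun x : ℝ => P.eval (x : ℂ) * Complex.exp (-(b / 2) * (x : ℂ) ^ 2))
      ((derivative P - C b * X * P).eval (x : ℂ) * Complex.exp (-(b / 2) * (x : ℂ) ^ 2)) x := by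
  have h := ((P.hasDerivAt (x : ℂ)).mul
    (((hasDerivAt_pow 2 (x : ℂ)).const_mul (-(b / 2))).cexp)).comp_ofReal
  refine h.congr_deriv ?_
  simp only [eval_sub, eval_mul, eval_C, eval_X]
  push_cast
  ring

theorem iteratedDeriv_polynomial_mul_gaussian (b : ℂ) (P : Polynomial ℂ) (k : ℕ) :
    ∃ Q : Polynomial ℂ, iteratedDeriv k
      (fun x : ℝ => P.eval (x : ℂ) * Complex.exp (-(b / 2) * (x : ℂ) ^ 2))
        = fun x : ℝ => Q.eval (x : ℂ) * Complex.exp (-(b / 2) * (x : ℂ) ^ 2) := by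
  induction k generalizing P with
  | zero => exact ⟨P, iteratedDeriv_zero⟩
  | succ k ih =>
    rw [iteratedDeriv_succ', funext fun x => (hasDerivAt_polynomial_mul_gaussian b P x).deriv]
    exact ih _

theorem abs_pow_mul_exp_neg_mul_sq_le {r : ℝ} (hr : 0 < r) (n : ℕ) (x : ℝ) :
    |x| ^ n * Real.exp (-r * x ^ 2) ≤ 1 + n.factorial / r ^ n := by
  have h₁ : |x| ^ n ≤ 1 + (x ^ 2) ^ n := by
    rw [← sq_abs, ← pow_mul, mul_comm, pow_mul]
    nlinarith [sq_nonneg (|x| ^ n - 1)]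
  have h₂ : (x ^ 2) ^ n ≤ n.factorial / r ^ n * Real.exp (r * x ^ 2) := by
    have h := Real.pow_div_factorial_le_exp (r * x ^ 2) (by positivity) n
    rw [div_le_iff₀ (by positivity), mul_pow] at h
    rw [div_mul_eq_mul_div, le_div_iff₀ (by positivity)]
    linarith
  have h₃ : (1 : ℝ) ≤ Real.exp (r * x ^ 2) := Real.one_le_exp (by positivity)
  rw [neg_mul, Real.exp_neg, ← div_eq_mul_inv, div_le_iff₀ (Real.exp_pos _)]
  linarith

theorem exists_norm_polynomial_mul_gaussian_le {b : ℂ} (hb : 0 < b.re) (P : Polynomial ℂ) :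
    ∃ M : ℝ, ∀ x : ℝ, ‖P.eval (x : ℂ) * Complex.exp (-(b / 2) * (x : ℂ) ^ 2)‖ ≤ M := by
  induction P using Polynomial.induction_on' with
  | add p q hp hq =>
    obtain ⟨M, hM⟩ := hp
    obtain ⟨N, hN⟩ := hq
    refine ⟨M + N, fun x => ?_⟩
    rw [Polynomial.eval_add, add_mul]
    exact norm_add_le_of_le (hM x) (hN x)
  | monomial n a =>
    refine ⟨‖a‖ * (1 + n.factorial / (b.re / 2) ^ n), fun x => ?_⟩
    have hre : (-(b / 2) * (x : ℂ) ^ 2).re = -(b.re / 2) * x ^ 2 := by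
      rw [← Complex.ofReal_pow, Complex.re_mul_ofReal]
      simp
    rw [Polynomial.eval_monomial, mul_assoc, norm_mul, norm_mul, norm_pow, Complex.norm_real,
      Complex.norm_exp, hre, Real.norm_eq_abs]
    exact mul_le_mul_of_nonneg_left (abs_pow_mul_exp_neg_mul_sq_le (half_pos hb) n x)
      (norm_nonneg a)

/-- The product of a polynomial with the Gaussian `exp (-b x² / 2)`, `0 < re b`, as a Schwartz
function. -/
noncomputable def polynomialMulGaussian {b : ℂ} (hb : 0 < b.re) (P : Polynomial ℂ) :
    SchwartzMap ℝ ℂ where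
  toFun x := P.eval (x : ℂ) * Complex.exp (-(b / 2) * (x : ℂ) ^ 2)
  smooth' := by
    have h : ContDiff ℂ (⊤ : ℕ∞) fun z : ℂ => P.eval z * Complex.exp (-(b / 2) * z ^ 2) :=
      (by simpa using P.contDiff_aeval (𝕜 := ℂ) _ : ContDiff ℂ _ fun z : ℂ => P.eval z).mul
        (by fun_prop)
    exact (h.restrict_scalars ℝ).comp Complex.ofRealCLM.contDiff
  decay' k n := by
    obtain ⟨Q, hQ⟩ := iteratedDeriv_polynomial_mul_gaussian b P n
    obtain ⟨M, hM⟩ := exists_norm_polynomial_mul_gaussian_le hb (Polynomial.X ^ k * Q)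
    refine ⟨M, fun x => ?_⟩
    have h := hM x
    rw [Polynomial.eval_mul, Polynomial.eval_pow, Polynomial.eval_X, mul_assoc, norm_mul, norm_pow,
      Complex.norm_real] at h
    rw [norm_iteratedFDeriv_eq_norm_iteratedDeriv, hQ]
    exact h

theorem polynomialMulGaussian_ne_zero {b : ℂ} (hb : 0 < b.re) {P : Polynomial ℂ} (hP : P ≠ 0) :
    polynomialMulGaussian hb P ≠ 0 := by
  refine fun h => hP (P.eq_zero_of_infinite_isRoot
    ((Set.infinite_range_of_injective Complex.ofReal_injective).mono ?_))
  rintro _ ⟨x, rfl⟩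
  have hx : P.eval (x : ℂ) * Complex.exp (-(b / 2) * (x : ℂ) ^ 2) = 0 := DFunLike.congr_fun h x
  exact (mul_eq_zero.1 hx).resolve_right (Complex.exp_ne_zero _)

/-- The complex numbers `e^{iα/2}(2n+1)` are eigenvalues of the rotated harmonic oscillator
`−d²/dx² + e^{iα}x²`, with Schwartz eigenfunctions. -/
theorem rotated_harmonic_oscillator_eigenvalues (α : ℝ) (hα₀ : 0 ≤ α) (hα : α < π / 2)
    (n : ℕ) :
    ∃ u : SchwartzMap ℝ ℂ, u ≠ 0 ∧
      ∀ x : ℝ, -(deriv (deriv (u : ℝ → ℂ)) x)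
          + Complex.exp (α * Complex.I) * (x : ℂ) ^ 2 * u x
        = Complex.exp ((α / 2 : ℝ) * Complex.I) * (2 * n + 1) * u x := by
  have hsq : Complex.exp (α * Complex.I) = Complex.exp ((α / 2 : ℝ) * Complex.I) ^ 2 := by
    rw [← Complex.exp_nat_mul]
    push_cast
    ring_nf
  have hb : 0 < (Complex.exp ((α / 2 : ℝ) * Complex.I)).re := by
    rw [Complex.exp_ofReal_mul_I_re]
    exact Real.cos_pos_of_mem_Ioo ⟨by linarith [Real.pi_pos], by linarith [Real.pi_pos]⟩
  rw [hsq]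
  have hb₀ : Complex.exp ((α / 2 : ℝ) * Complex.I) ≠ 0 := Complex.exp_ne_zero _
  generalize Complex.exp ((α / 2 : ℝ) * Complex.I) = b at hb hb₀ ⊢
  refine ⟨polynomialMulGaussian hb (rotatedHermite b n),
    polynomialMulGaussian_ne_zero hb (rotatedHermite_ne_zero hb₀ n), fun x => ?_⟩
  have hu (P : Polynomial ℂ) : (polynomialMulGaussian hb P : ℝ → ℂ) =
      fun x : ℝ => P.eval (x : ℂ) * Complex.exp (-(b / 2) * (x : ℂ) ^ 2) := rfl
  have hode := congrArg (Polynomial.eval (x : ℂ)) (rotatedHermite_ode b n)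
  simp only [Polynomial.eval_sub, Polynomial.eval_mul, Polynomial.eval_C,
    Polynomial.eval_X] at hode
  rw [hu, funext fun x => (hasDerivAt_polynomial_mul_gaussian b (rotatedHermite b n) x).deriv,
    (hasDerivAt_polynomial_mul_gaussian b _ x).deriv]
  simp only [Polynomial.derivative_sub, Polynomial.derivative_mul, Polynomial.derivative_C,
    Polynomial.derivative_X, Polynomial.eval_sub, Polynomial.eval_add, Polynomial.eval_mul,
    Polynomial.eval_C, Polynomial.eval_X, Polynomial.eval_zero, Polynomial.eval_one, hode]
  ring
end
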